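/- arXiv:1901.02799 — 3 statements merged into one kernel-verified Lean document; each statement's English description precedes it below -/
import Mathlib

section
/- Mittag-Leffler solution of the fractional relaxation equation: let 1 < α < 2 and λ > 0, and define y(t) := λ^{-1}(1 − E_{α,1}(−λ t^α)) for t ≥ 0. Then the function t ↦ (D_{0+}^{-(2−α)} y)(t) is twice differentiable on (0,∞), and for every t > 0, (D_{0+}^{α} y)(t) + λ y(t) = 1. -/
open MeasureTheory Set

/-- Left Riemann–Liouville fractional integral of order `γ` (with base point `0`);
`D_{0+}^{0}` is the identity. -/
noncomputable def rlIntL (a γ : ℝ) (v : ℝ → ℝ) (t : ℝ) : ℝ :=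
  if γ = 0 then v t
  else (Real.Gamma γ)⁻¹ * ∫ s in a..t, (t - s) ^ (γ - 1) * v s

/-- The (real) Mittag-Leffler function `E_{α,β}(z) = Σ_{n=0}^∞ zⁿ / Γ(nα + β)`. -/
noncomputable def mittagLeffler (α β z : ℝ) : ℝ :=
  ∑' n : ℕ, z ^ n / Real.Gamma (n * α + β)

lemma aux_beta {p γ t : ℝ} (hp : 0 ≤ p) (hγ : 0 < γ) (ht : 0 < t) :
    ∫ s in Ioc 0 t, (t - s) ^ (γ - 1) * s ^ p =
      t ^ (p + γ) * (Real.Gamma (p + 1) * Real.Gamma γ / Real.Gamma (p + 1 + γ)) := by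
  have h := Complex.betaIntegral_scaled ((p + 1 : ℝ) : ℂ) (γ : ℂ) ht
  rw [Complex.betaIntegral_eq_Gamma_mul_div ((p + 1 : ℝ) : ℂ) (γ : ℂ) (by simp; linarith) (by simpa using hγ),
    intervalIntegral.integral_of_le ht.le] at h
  have h2 : ∫ x in Ioc 0 t, (x : ℂ) ^ (((p + 1 : ℝ) : ℂ) - 1) * ((t : ℂ) - x) ^ ((γ : ℂ) - 1)
      = ∫ x in Ioc 0 t, (((t - x) ^ (γ - 1) * x ^ p : ℝ) : ℂ) := by
    refine setIntegral_congr_fun measurableSet_Ioc fun x hx => ?_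
    have h1 : ((p + 1 : ℝ) : ℂ) - 1 = (p : ℂ) := by push_cast; ring
    have h2 : (γ : ℂ) - 1 = ((γ - 1 : ℝ) : ℂ) := by push_cast; ring
    have h3 : (t : ℂ) - x = ((t - x : ℝ) : ℂ) := by push_cast; ring
    rw [h1, h2, h3, ← Complex.ofReal_cpow hx.1.le, ← Complex.ofReal_cpow (by linarith [hx.2])]
    push_cast; ring
  rw [h2, integral_complex_ofReal] at h
  have h4 : ((p + 1 : ℝ) : ℂ) + γ - 1 = ((p + γ : ℝ) : ℂ) := by push_cast; ring
  rw [h4, ← Complex.ofReal_add, Complex.Gamma_ofReal, Complex.Gamma_ofReal, Complex.Gamma_ofReal,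
    ← Complex.ofReal_cpow ht.le] at h
  exact_mod_cast h

lemma aux_gamma {α k : ℝ} (hα : 1 < α) (hk : k = 0 ∨ 1 ≤ k) (m : ℕ) :
    (m.factorial : ℝ) ≤ Real.Gamma (α * m + k + 1) := by
  have hmono := Real.Gamma_strictMonoOn_Ici.monotoneOn
  rcases Nat.eq_zero_or_pos m with rfl | hm
  · rcases hk with rfl | hk
    · simp
    · have := hmono (a := 2) (b := k + 1) (by simp) (by simp; linarith) (by linarith)
      rw [Real.Gamma_two] at this
      simpa using this
  · have hm1 : (1 : ℝ) ≤ m := by exact_mod_cast hm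
    have hk0 : 0 ≤ k := by rcases hk with rfl | hk <;> linarith
    have hle : (m : ℝ) + 1 ≤ α * m + k + 1 := by nlinarith
    rw [← Real.Gamma_nat_eq_factorial]
    exact hmono (by simp; linarith) (by simp; linarith) hle

noncomputable def auxg (α lam k : ℝ) (m : ℕ) (t : ℝ) : ℝ :=
  (-lam) ^ m * (t ^ (α * m + k) / Real.Gamma (α * m + k + 1))

lemma auxg_bound {α lam k : ℝ} (hα : 1 < α) (hlam : 0 < lam) (hk : k = 0 ∨ 1 ≤ k) (m : ℕ)
    {t R : ℝ} (ht : 0 < t) (htR : t ≤ R) :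
    ‖auxg α lam k m t‖ ≤ R ^ k * ((lam * R ^ α) ^ m / m.factorial) := by
  have hk0 : 0 ≤ k := by rcases hk with rfl | hk <;> linarith
  have hR : 0 < R := ht.trans_le htR
  have hG := aux_gamma hα hk m
  have hf : (0 : ℝ) < m.factorial := by exact_mod_cast m.factorial_pos
  have e : R ^ k * ((lam * R ^ α) ^ m / m.factorial)
      = lam ^ m * (R ^ (α * m + k) / m.factorial) := by
    rw [Real.rpow_add hR, Real.rpow_mul hR.le, Real.rpow_natCast, mul_pow]; ring
  rw [e, auxg, norm_mul, norm_pow, norm_neg, norm_div, Real.norm_of_nonneg hlam.le,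
    Real.norm_of_nonneg (Real.rpow_nonneg ht.le _), Real.norm_of_nonneg (hf.le.trans hG)]
  have : t ^ (α * m + k) ≤ R ^ (α * m + k) :=
    Real.rpow_le_rpow ht.le htR (by positivity)
  gcongr

lemma auxg_summable_bound (α lam k R : ℝ) :
    Summable fun m : ℕ => R ^ k * ((lam * R ^ α) ^ m / m.factorial) :=
  (Real.summable_pow_div_factorial _).mul_left _

lemma auxg_summable {α lam k : ℝ} (hα : 1 < α) (hlam : 0 < lam) (hk : k = 0 ∨ 1 ≤ k)
    {t : ℝ} (ht : 0 < t) : Summable fun m => ‖auxg α lam k m t‖ :=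
  Summable.of_nonneg_of_le (fun _ => norm_nonneg _)
    (fun m => auxg_bound hα hlam hk m ht le_rfl) (auxg_summable_bound α lam k t)

lemma auxg_deriv {α lam k : ℝ} (hα : 1 < α) (hlam : 0 < lam) (hk : k = 0 ∨ 1 ≤ k)
    {t : ℝ} (ht : 0 < t) :
    HasDerivAt (fun z => ∑' m, auxg α lam (k + 1) m z) (∑' m, auxg α lam k m t) t := by
  have hk0 : 0 ≤ k := by rcases hk with rfl | hk <;> linarith
  refine hasDerivAt_tsum_of_isPreconnected (g := fun m z => auxg α lam (k + 1) m z)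
    (g' := fun m z => auxg α lam k m z) (auxg_summable_bound α lam k (t + 1))
    (isOpen_Ioo (a := 0) (b := t + 1)) isPreconnected_Ioo (y₀ := t) ?_ ?_ ⟨ht, by linarith⟩ ?_
    ⟨ht, by linarith⟩
  · intro m z hz
    have hp : 0 < α * m + k + 1 := by positivity
    have h := ((Real.hasDerivAt_rpow_const (x := z) (p := α * m + (k + 1))
      (Or.inl hz.1.ne')).div_const (Real.Gamma (α * m + (k + 1) + 1))).const_mul ((-lam) ^ m)
    refine h.congr_deriv ?_
    simp only [auxg]
    rw [ ← add_assoc (α * m) k 1, Real.Gamma_add_one hp.ne']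
    have := (Real.Gamma_pos_of_pos hp).ne'
    rw [add_sub_cancel_right]
    field_simp
  · intro m z hz
    exact auxg_bound hα hlam hk m hz.1 hz.2.le
  · exact (auxg_summable hα hlam (Or.inr (by linarith)) ht).of_norm

lemma auxy {α lam : ℝ} (hα : 1 < α) (hlam : 0 < lam) {t : ℝ} (ht : 0 < t) :
    mittagLeffler α 1 (-lam * t ^ α) = ∑' m, auxg α lam 0 m t := by
  unfold mittagLeffler auxg
  congr 1; ext m
  rw [mul_pow, add_zero, Real.rpow_mul ht.le, Real.rpow_natCast, mul_comm (m : ℝ) α]; ring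

lemma auxy2 {α lam : ℝ} (hα : 1 < α) (hlam : 0 < lam) {t : ℝ} (ht : 0 < t) :
    lam⁻¹ * (1 - mittagLeffler α 1 (-lam * t ^ α)) = ∑' m, auxg α lam α m t := by
  rw [auxy hα hlam ht, (auxg_summable hα hlam (Or.inl rfl) ht).of_norm.tsum_eq_zero_add]
  have h0 : auxg α lam 0 0 t = 1 := by simp [auxg]
  rw [h0, sub_add_cancel_left, ← tsum_neg, ← tsum_mul_left]
  congr 1; ext m
  unfold auxg
  have e : α * ((m + 1 : ℕ) : ℝ) + 0 = α * m + α := by push_cast; ring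
  rw [e, pow_succ]
  field_simp

lemma aux_rl {α lam : ℝ} (hα : 1 < α) (hα2 : α < 2) (hlam : 0 < lam) (y : ℝ → ℝ)
    (hy : ∀ t, y t = lam⁻¹ * (1 - mittagLeffler α 1 (-lam * t ^ α))) {t : ℝ} (ht : 0 < t) :
    rlIntL 0 (2 - α) y t = ∑' m, auxg α lam 2 m t := by
  have hγ : 0 < 2 - α := by linarith
  have hG := Real.Gamma_pos_of_pos hγ
  rw [rlIntL, if_neg hγ.ne', intervalIntegral.integral_of_le ht.le]
  have hp : ∀ m : ℕ, 0 ≤ α * m + α := fun m => by positivity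
  have hgp : ∀ m : ℕ, 0 < Real.Gamma (α * m + α + 1) := fun m =>
    Real.Gamma_pos_of_pos (by linarith [hp m])
  have hgp2 : ∀ m : ℕ, 0 < Real.Gamma (α * m + 2 + 1) := fun m =>
    Real.Gamma_pos_of_pos (by positivity)
  have hb : ∀ m : ℕ, ∫ s in Ioc 0 t, (t - s) ^ (2 - α - 1) * s ^ (α * m + α) =
      Real.Gamma (2 - α) * Real.Gamma (α * m + α + 1) *
        (t ^ (α * m + 2) / Real.Gamma (α * m + 2 + 1)) := by
    intro m
    rw [aux_beta (hp m) hγ ht]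
    rw [show α * m + α + (2 - α) = α * m + 2 by ring,
      show α * m + α + 1 + (2 - α) = α * m + 2 + 1 by ring]
    ring
  have hint0 : ∀ m : ℕ, Integrable (fun s => (t - s) ^ (2 - α - 1) * s ^ (α * m + α))
      (volume.restrict (Ioc 0 t)) := by
    intro m
    by_contra hc
    have h := hb m
    rw [integral_undef hc] at h
    have h1 := hgp m
    have h2 := hgp2 m
    have : 0 < Real.Gamma (2 - α) * Real.Gamma (α * m + α + 1) *
        (t ^ (α * m + 2) / Real.Gamma (α * m + 2 + 1)) := by positivity
    linarith
  let F : ℕ → ℝ → ℝ := fun m s => (t - s) ^ (2 - α - 1) * auxg α lam α m s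
  have hF : ∀ m, F m = fun s => ((-lam) ^ m / Real.Gamma (α * m + α + 1)) *
      ((t - s) ^ (2 - α - 1) * s ^ (α * m + α)) := by
    intro m; ext s; simp only [F, auxg]; ring
  have hFint : ∀ m, Integrable (F m) (volume.restrict (Ioc 0 t)) := by
    intro m; rw [hF]; exact (hint0 m).const_mul _
  have hFi : ∀ m, ∫ s in Ioc 0 t, F m s = Real.Gamma (2 - α) * auxg α lam 2 m t := by
    intro m
    rw [hF, integral_const_mul, hb, auxg]
    have h1 := hgp m
    have h2 := hgp2 m
    field_simp
  have hFn : ∀ m, ∫ s in Ioc 0 t, ‖F m s‖ = Real.Gamma (2 - α) * ‖auxg α lam 2 m t‖ := by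
    intro m
    have h1 := hgp m
    have h2 := hgp2 m
    have : ∫ s in Ioc 0 t, ‖F m s‖ = ∫ s in Ioc 0 t,
        (lam ^ m / Real.Gamma (α * m + α + 1)) * ((t - s) ^ (2 - α - 1) * s ^ (α * m + α)) := by
      refine setIntegral_congr_fun measurableSet_Ioc fun s hs => ?_
      have h3 : 0 ≤ (t - s) ^ (2 - α - 1) := Real.rpow_nonneg (by linarith [hs.2]) _
      have h4 : 0 ≤ s ^ (α * m + α) := Real.rpow_nonneg hs.1.le _
      simp only [hF]
      rw [norm_mul, norm_div, norm_pow, norm_neg, Real.norm_of_nonneg hlam.le,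
        Real.norm_of_nonneg h1.le, Real.norm_of_nonneg (mul_nonneg h3 h4)]
    rw [this, integral_const_mul, hb, auxg, norm_mul, norm_div, norm_pow, norm_neg,
      Real.norm_of_nonneg hlam.le, Real.norm_of_nonneg h2.le,
      Real.norm_of_nonneg (Real.rpow_nonneg ht.le _)]
    field_simp
  have hsum := hasSum_integral_of_summable_integral_norm hFint (by
    simp_rw [hFn]
    exact (auxg_summable hα hlam (Or.inr (by norm_num)) ht).mul_left _)
  simp_rw [hFi] at hsum
  have hc : ∫ s in Ioc 0 t, (t - s) ^ (2 - α - 1) * y s = ∫ s in Ioc 0 t, ∑' m, F m s := by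
    refine setIntegral_congr_fun measurableSet_Ioc fun s hs => ?_
    simp only [F]
    rw [hy, auxy2 hα hlam hs.1, tsum_mul_left]
  rw [hc, ← hsum.tsum_eq, tsum_mul_left, ← mul_assoc, inv_mul_cancel₀ hG.ne', one_mul]

/-- The Mittag-Leffler function `y(t) = λ⁻¹(1 - E_{α,1}(-λ tᵅ))` solves the fractional
relaxation equation `D_{0+}^{α} y + λ y = 1` on `(0,∞)`, where
`D_{0+}^{α} y = (d/dt)² D_{0+}^{-(2-α)} y`. -/
theorem stmt9 (α lam : ℝ) (hα1 : 1 < α) (hα2 : α < 2) (hlam : 0 < lam)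
    (y : ℝ → ℝ)
    (hy : ∀ t, y t = lam⁻¹ * (1 - mittagLeffler α 1 (-lam * t ^ α))) :
    (∀ t ∈ Set.Ioi (0 : ℝ),
      DifferentiableAt ℝ (rlIntL 0 (2 - α) y) t ∧
      DifferentiableAt ℝ (deriv (rlIntL 0 (2 - α) y)) t) ∧
    ∀ t > (0 : ℝ), deriv (deriv (rlIntL 0 (2 - α) y)) t + lam * y t = 1 := by
  have hev : ∀ t > (0 : ℝ), HasDerivAt (rlIntL 0 (2 - α) y) (∑' m, auxg α lam 1 m t) t := by
    intro t ht
    have h := auxg_deriv (k := 1) hα1 hlam (Or.inr le_rfl) ht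
    rw [one_add_one_eq_two] at h
    refine h.congr_of_eventuallyEq ?_
    filter_upwards [Ioi_mem_nhds ht] with s hs
    exact aux_rl hα1 hα2 hlam y hy hs
  have hev2 : ∀ t > (0 : ℝ),
      HasDerivAt (deriv (rlIntL 0 (2 - α) y)) (∑' m, auxg α lam 0 m t) t := by
    intro t ht
    have h := auxg_deriv (k := 0) hα1 hlam (Or.inl rfl) ht
    rw [zero_add] at h
    refine h.congr_of_eventuallyEq ?_
    filter_upwards [Ioi_mem_nhds ht] with s hs
    exact (hev s hs).deriv
  refine ⟨fun t ht => ⟨(hev t ht).differentiableAt, (hev2 t ht).differentiableAt⟩, fun t ht => ?_⟩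
  rw [(hev2 t ht).deriv, hy, auxy hα1 hlam ht]
  field_simp
  ring
end

section
/- Second derivative of the regular part of the Mittag-Leffler solution: let 1 < α < 2 and λ > 0, and define y(t) := λ^{-1}(1 − E_{α,1}(−λ t^α)) and w(t) := t^α / Γ(α+1) for t ≥ 0. Then y − w is twice differentiable on (0,∞) and (y − w)''(t) = −λ t^{2α−2} E_{α,2α−1}(−λ t^α) for every t > 0. -/
open MeasureTheory Set

theorem ml_summable (α β x : ℝ) (hα : 1 < α) (hβ : 1 ≤ β) :
    Summable (fun n : ℕ => x ^ n / Real.Gamma (n * α + β)) := by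
  refine Summable.of_norm_bounded_eventually_nat (g := fun n : ℕ => |x| ^ n / (n.factorial : ℝ))
    (Real.summable_pow_div_factorial _) ?_
  filter_upwards [Filter.eventually_ge_atTop 1] with n hn
  have hn' : (1 : ℝ) ≤ n := by exact_mod_cast hn
  have h1 : (n : ℝ) + 1 ≤ n * α + β := by nlinarith
  have h2 : (n.factorial : ℝ) ≤ Real.Gamma (n * α + β) := by
    rw [← Real.Gamma_nat_eq_factorial]
    exact Real.Gamma_strictMonoOn_Ici.monotoneOn (by simp; linarith) (by simp; linarith) h1
  have h3 : (0 : ℝ) < n.factorial := by positivity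
  rw [norm_div, norm_pow, Real.norm_eq_abs, Real.norm_eq_abs, abs_of_pos (h3.trans_le h2)]
  gcongr

theorem ml_term (α γ lam s : ℝ) (hs : 0 < s) (n : ℕ) (δ : ℝ) :
    s ^ δ * ((-lam * s ^ α) ^ n / Real.Gamma γ)
      = (-lam) ^ n * s ^ (n * α + δ) / Real.Gamma γ := by
  rw [Real.rpow_add hs, mul_comm (n : ℝ) α, Real.rpow_mul hs.le, Real.rpow_natCast, mul_pow]
  ring

theorem ml_hasDerivAt (α γ lam t : ℝ) (hα : 1 < α) (hγ : 2 ≤ γ) (ht : 0 < t) :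
    HasDerivAt (fun s => s ^ (γ - 1) * mittagLeffler α γ (-lam * s ^ α))
      (t ^ (γ - 2) * mittagLeffler α (γ - 1) (-lam * t ^ α)) t := by
  set T := t + 1 with hT
  have hTpos : 0 < T := by linarith
  have key := hasDerivAt_tsum_of_isPreconnected
    (g := fun (n : ℕ) (s : ℝ) => s ^ (γ - 1) * ((-lam * s ^ α) ^ n / Real.Gamma (n * α + γ)))
    (g' := fun (n : ℕ) (s : ℝ) =>
      s ^ (γ - 2) * ((-lam * s ^ α) ^ n / Real.Gamma (n * α + (γ - 1))))
    (u := fun n : ℕ => T ^ (γ - 2) * ((|lam| * T ^ α) ^ n / Real.Gamma (n * α + (γ - 1))))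
    (t := Ioo 0 T) (y₀ := t) (y := t)
    ((ml_summable α (γ - 1) _ hα (by linarith)).mul_left _) isOpen_Ioo isPreconnected_Ioo
    ?_ ?_ ⟨ht, by linarith⟩ ((ml_summable α γ _ hα (by linarith)).mul_left _) ⟨ht, by linarith⟩
  · simpa only [mittagLeffler, ← tsum_mul_left] using key
  · intro n s hs
    have hs0 : 0 < s := hs.1
    have hn : (0 : ℝ) ≤ n * α := by positivity
    have hp : 0 < n * α + (γ - 1) := by linarith
    have hG : Real.Gamma (n * α + γ) = (n * α + (γ - 1)) * Real.Gamma (n * α + (γ - 1)) := by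
      rw [← Real.Gamma_add_one hp.ne']; congr 1; ring
    have hGp := Real.Gamma_pos_of_pos hp
    have hd : HasDerivAt (fun s : ℝ => (-lam) ^ n * s ^ (n * α + (γ - 1)) / Real.Gamma (n * α + γ))
        ((-lam) ^ n * ((n * α + (γ - 1)) * s ^ (n * α + (γ - 1) - 1)) / Real.Gamma (n * α + γ)) s :=
      ((Real.hasDerivAt_rpow_const (Or.inl hs0.ne')).const_mul _).div_const _
    have hev : (fun s : ℝ => s ^ (γ - 1) * ((-lam * s ^ α) ^ n / Real.Gamma (n * α + γ))) =ᶠ[nhds s]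
        (fun s : ℝ => (-lam) ^ n * s ^ (n * α + (γ - 1)) / Real.Gamma (n * α + γ)) := by
      filter_upwards [Ioi_mem_nhds hs0] with r hr
      exact ml_term _ _ _ _ hr _ _
    convert hd.congr_of_eventuallyEq hev using 1
    rw [ml_term _ _ _ _ hs0, hG, show n * α + (γ - 1) - 1 = n * α + (γ - 2) by ring]
    field_simp
  · intro n s hs
    have hs0 : 0 < s := hs.1
    have hn : (0 : ℝ) ≤ n * α := by positivity
    have hGp := Real.Gamma_pos_of_pos (show 0 < n * α + (γ - 1) by linarith)
    have h1 : 0 < s ^ α := Real.rpow_pos_of_pos hs0 _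
    have h2 : 0 < s ^ (γ - 2) := Real.rpow_pos_of_pos hs0 _
    have h3 : s ^ α ≤ T ^ α := Real.rpow_le_rpow hs0.le hs.2.le (by linarith)
    have h4 : s ^ (γ - 2) ≤ T ^ (γ - 2) := Real.rpow_le_rpow hs0.le hs.2.le (by linarith)
    simp only [norm_mul, norm_div, norm_pow, norm_neg, Real.norm_eq_abs, abs_of_pos h1,
      abs_of_pos h2, abs_of_pos hGp]
    gcongr

theorem ml_split (α z : ℝ) (hα : 1 < α) :
    mittagLeffler α 1 z = 1 + z / Real.Gamma (α + 1) + z ^ 2 * mittagLeffler α (2 * α + 1) z := by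
  unfold mittagLeffler
  rw [← (ml_summable α 1 z hα le_rfl).sum_add_tsum_nat_add 2, ← tsum_mul_left]
  simp only [Finset.sum_range_succ, Finset.sum_range_zero]
  congr 1
  · simp
  · refine tsum_congr fun n => ?_
    rw [show ((n + 2 : ℕ) : ℝ) * α + 1 = n * α + (2 * α + 1) by push_cast; ring]
    ring

/-- Second derivative of the regular part of the Mittag-Leffler solution:
`(y - w)''(t) = -λ t^{2α-2} E_{α,2α-1}(-λ tᵅ)` for `t > 0`, where
`y(t) = λ⁻¹(1 - E_{α,1}(-λ tᵅ))` and `w(t) = tᵅ / Γ(α+1)`. -/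
theorem stmt11 (α lam : ℝ) (hα1 : 1 < α) (hα2 : α < 2) (hlam : 0 < lam)
    (y w : ℝ → ℝ)
    (hy : ∀ t, y t = lam⁻¹ * (1 - mittagLeffler α 1 (-lam * t ^ α)))
    (hw : ∀ t, w t = t ^ α / Real.Gamma (α + 1)) :
    (∀ t ∈ Set.Ioi (0 : ℝ),
      DifferentiableAt ℝ (fun s => y s - w s) t ∧
      DifferentiableAt ℝ (deriv fun s => y s - w s) t) ∧
    ∀ t > (0 : ℝ), deriv (deriv fun s => y s - w s) t =
      -lam * t ^ (2 * α - 2) * mittagLeffler α (2 * α - 1) (-lam * t ^ α) := by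
  have h0 : ∀ s > (0 : ℝ), y s - w s =
      -lam * (s ^ (2 * α + 1 - 1) * mittagLeffler α (2 * α + 1) (-lam * s ^ α)) := by
    intro s hs
    have e : s ^ (2 * α + 1 - 1) = (s ^ α) ^ 2 := by
      rw [← Real.rpow_natCast, ← Real.rpow_mul hs.le]; congr 1; push_cast; ring
    have hG := Real.Gamma_pos_of_pos (show 0 < α + 1 by linarith)
    rw [hy, hw, ml_split _ _ hα1, e]
    field_simp
    ring
  have h1 : ∀ t > (0 : ℝ), HasDerivAt (fun s => y s - w s)
      (-lam * (t ^ (2 * α - 1) * mittagLeffler α (2 * α) (-lam * t ^ α))) t := by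
    intro t ht
    have h := (ml_hasDerivAt α (2 * α + 1) lam t hα1 (by linarith) ht).const_mul (-lam)
    rw [show 2 * α + 1 - 2 = 2 * α - 1 by ring] at h
    rw [show (2 * α + 1 - 1 : ℝ) = 2 * α by ring] at h h0
    refine h.congr_of_eventuallyEq ?_
    filter_upwards [Ioi_mem_nhds ht] with s hs
    exact h0 s hs
  have h2 : ∀ t > (0 : ℝ), HasDerivAt (deriv fun s => y s - w s)
      (-lam * (t ^ (2 * α - 2) * mittagLeffler α (2 * α - 1) (-lam * t ^ α))) t := by
    intro t ht
    have h := (ml_hasDerivAt α (2 * α) lam t hα1 (by linarith) ht).const_mul (-lam)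
    refine h.congr_of_eventuallyEq ?_
    filter_upwards [Ioi_mem_nhds ht] with s hs
    exact (h1 s hs).deriv
  refine ⟨fun t ht => ⟨(h1 t ht).differentiableAt, (h2 t ht).differentiableAt⟩, fun t ht => ?_⟩
  rw [(h2 t ht).deriv]
  ring
end

section
/- Weighted Hardy-type bound via the Gagliardo seminorm: for all β, s with 0 < β < 1/2 and β ≤ s < 1 there exists a constant C_{β,s} > 0 such that every measurable function z : (0,1) → ℝ with finite ‖z‖²_{L²(0,1)} and finite Gagliardo seminorm [z]_s² := ∫_0^1 ∫_0^1 |z(x) − z(y)|² / |x − y|^{1+2s} dx dy satisfies ∫_0^1 |z(t)|² (t^{−2β} + (1−t)^{−2β}) dt ≤ C_{β,s} (‖z‖²_{L²(0,1)} + [z]_s²). -/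
open MeasureTheory Set

/-- The squared Gagliardo seminorm `[z]_s²` of a function on `(0,1)`, as a Lebesgue
(lower) integral with values in `ℝ≥0∞`. -/
noncomputable def gagliardoSq (s : ℝ) (z : ℝ → ℝ) : ENNReal :=
  ∫⁻ x in Set.Ioo (0 : ℝ) 1, ∫⁻ y in Set.Ioo (0 : ℝ) 1,
    ENNReal.ofReal ((z x - z y) ^ 2 / |x - y| ^ (1 + 2 * s))

lemma hk_int (β : ℝ) (hβ0 : 0 < β) (c : ℝ) (hc : 0 < c) :
    ∫⁻ t in Set.Ioi c, ENNReal.ofReal (t ^ (-(2 * β) - 1))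
      = ENNReal.ofReal (c ^ (-(2 * β)) / (2 * β)) := by
  rw [← ofReal_integral_eq_lintegral_ofReal]
  · rw [integral_Ioi_rpow_of_lt (by linarith) hc]
    congr 1
    rw [show -(2 * β) - 1 + 1 = -(2 * β) by ring, neg_div_neg_eq]
  · exact integrableOn_Ioi_rpow_of_lt (by linarith) hc
  · filter_upwards [ae_restrict_mem measurableSet_Ioi] with t ht
    have : 0 < t := hc.trans ht
    positivity

lemma exists_b (β : ℝ) (hβ0 : 0 < β) (hβ : β < 1 / 2) :
    ∃ b : ℝ, 1 < b ∧ 2 / (b - 1) * (b ^ (2 * β) / (2 * β)) ≤ 1 / 2 := by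
  have h1 := tendsto_rpow_neg_atTop (y := 1 - 2 * β) (by linarith)
  have h2 := h1.eventually (gt_mem_nhds (show (0 : ℝ) < β / 4 by positivity))
  obtain ⟨b, hb, hb2⟩ := (h2.and (Filter.eventually_ge_atTop (2 : ℝ))).exists
  refine ⟨b, by linarith, ?_⟩
  have hb0 : 0 < b := by linarith
  have e : b ^ (2 * β) = b * b ^ (-(1 - 2 * β)) := by
    nth_rewrite 2 [← Real.rpow_one b]
    rw [← Real.rpow_add hb0]; congr 1; ring
  rw [e]
  set q := b ^ (-(1 - 2 * β))
  rw [div_mul_div_comm, div_le_div_iff₀ (by nlinarith) (by norm_num)]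
  nlinarith [mul_lt_mul_of_pos_left hb hb0]

lemma ptwise (β s b : ℝ) (hβ0 : 0 < β) (hβs : β ≤ s) (hb : 1 < b) (u v t y : ℝ)
    (ht : 0 < t) (hty : t < y) (hy : y < b * t) (hy1 : y < 1) :
    u ^ 2 * t ^ (-(2 * β) - 1) / (b - 1) ≤
      2 * (b - 1) ^ (2 * β) * ((u - v) ^ 2 / |t - y| ^ (1 + 2 * s))
        + 2 / (b - 1) * (t ^ (-(2 * β) - 1) * v ^ 2) := by
  have hb' : 0 < b - 1 := by linarith
  have hd : |t - y| = y - t := by rw [abs_sub_comm, abs_of_pos (by linarith)]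
  rw [hd]
  have hd0 : 0 < y - t := by linarith
  have h1 : (y - t) ^ (1 + 2 * s) ≤ (y - t) ^ (1 + 2 * β) :=
    Real.rpow_le_rpow_of_exponent_ge hd0 (by linarith) (by linarith)
  have h2 : (y - t) ^ (1 + 2 * β) ≤ ((b - 1) * t) ^ (1 + 2 * β) :=
    Real.rpow_le_rpow hd0.le (by linarith) (by linarith)
  rw [Real.mul_rpow hb'.le ht.le] at h2
  have e1 : (b - 1) ^ (1 + 2 * β) = (b - 1) * (b - 1) ^ (2 * β) := by
    rw [Real.rpow_add hb', Real.rpow_one]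
  have e2 : t ^ (-(2 * β) - 1) = (t ^ (1 + 2 * β))⁻¹ := by
    rw [← Real.rpow_neg ht.le]; congr 1; ring
  rw [e1] at h2
  have hp : 0 < (y - t) ^ (1 + 2 * s) := by positivity
  have ht' : 0 < t ^ (1 + 2 * β) := by positivity
  have hB : 0 < (b - 1) ^ (2 * β) := by positivity
  rw [e2]
  set P := (y - t) ^ (1 + 2 * s)
  set T := t ^ (1 + 2 * β)
  set B := (b - 1) ^ (2 * β)
  have h3 : P ≤ (b - 1) * B * T := h1.trans h2
  have h4 : T⁻¹ / (b - 1) ≤ B / P := by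
    rw [inv_eq_one_div, div_div, div_le_div_iff₀ (by positivity) hp]
    linarith
  have h5 : u ^ 2 ≤ 2 * (u - v) ^ 2 + 2 * v ^ 2 := by nlinarith [sq_nonneg (u - 2 * v)]
  have h6 : 0 ≤ T⁻¹ / (b - 1) := by positivity
  calc u ^ 2 * T⁻¹ / (b - 1) = u ^ 2 * (T⁻¹ / (b - 1)) := by ring
    _ ≤ (2 * (u - v) ^ 2 + 2 * v ^ 2) * (T⁻¹ / (b - 1)) := by gcongr
    _ = 2 * (u - v) ^ 2 * (T⁻¹ / (b - 1)) + 2 * v ^ 2 * (T⁻¹ / (b - 1)) := by ring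
    _ ≤ 2 * (u - v) ^ 2 * (B / P) + 2 * v ^ 2 * (T⁻¹ / (b - 1)) := by gcongr
    _ = _ := by ring

lemma inner_bd (β s b : ℝ) (hβ0 : 0 < β) (hβs : β ≤ s) (hb : 1 < b) (δ : ℝ) (hδ : 0 < δ)
    (z : ℝ → ℝ) (hz : Measurable z) (t : ℝ) (ht : t ∈ Ioo δ (1 / b)) :
    ENNReal.ofReal (z t ^ 2 * t ^ (-(2 * β))) ≤
      ENNReal.ofReal (2 * (b - 1) ^ (2 * β)) * (∫⁻ y in Ioo (0 : ℝ) 1,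
        ENNReal.ofReal ((z t - z y) ^ 2 / |t - y| ^ (1 + 2 * s)))
      + ENNReal.ofReal (2 / (b - 1)) * ∫⁻ y in Ioo δ 1,
        (Ioi (y / b)).indicator (fun t => ENNReal.ofReal (t ^ (-(2 * β) - 1))) t
          * ENNReal.ofReal (z y ^ 2) := by
  have hb' : 0 < b - 1 := by linarith
  have hb0 : 0 < b := by linarith
  have ht0 : 0 < t := hδ.trans ht.1
  have htb : b * t < 1 := by
    have := ht.2
    rw [lt_div_iff₀ hb0] at this
    linarith
  have e0 : ENNReal.ofReal (z t ^ 2 * t ^ (-(2 * β))) =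
      ∫⁻ y in Ioo t (b * t), ENNReal.ofReal (z t ^ 2 * t ^ (-(2 * β) - 1) / (b - 1)) := by
    rw [setLIntegral_const, Real.volume_Ioo, ← ENNReal.ofReal_mul (by positivity)]
    congr 1
    rw [Real.rpow_sub ht0, Real.rpow_one]
    field_simp
  have hm1 : Measurable fun y => ENNReal.ofReal ((z t - z y) ^ 2 / |t - y| ^ (1 + 2 * s)) := by
    fun_prop
  rw [e0]
  calc _ ≤ ∫⁻ y in Ioo t (b * t), (ENNReal.ofReal (2 * (b - 1) ^ (2 * β)) *
        ENNReal.ofReal ((z t - z y) ^ 2 / |t - y| ^ (1 + 2 * s))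
        + ENNReal.ofReal (2 / (b - 1)) * ((Ioi (y / b)).indicator (fun t => ENNReal.ofReal (t ^ (-(2 * β) - 1))) t
          * ENNReal.ofReal (z y ^ 2))) := by
        apply setLIntegral_mono' measurableSet_Ioo
        intro y hy
        have hmem : t ∈ Ioi (y / b) := by
          rw [mem_Ioi, div_lt_iff₀ hb0]; linarith [hy.2]
        rw [indicator_of_mem hmem, ← ENNReal.ofReal_mul (by positivity),
          ← ENNReal.ofReal_mul (by positivity), ← ENNReal.ofReal_mul (by positivity),
          ← ENNReal.ofReal_add (by positivity) (by positivity)]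
        exact ENNReal.ofReal_le_ofReal
          (ptwise β s b hβ0 hβs hb _ _ t y ht0 hy.1 hy.2 (by linarith [hy.2]))
    _ = _ := lintegral_add_left (by fun_prop) _
    _ ≤ _ := by
        rw [lintegral_const_mul' _ _ ENNReal.ofReal_ne_top, lintegral_const_mul' _ _ ENNReal.ofReal_ne_top]
        have i1 : Ioo t (b * t) ⊆ Ioo 0 1 := Ioo_subset_Ioo ht0.le htb.le
        have i2 : Ioo t (b * t) ⊆ Ioo δ 1 := Ioo_subset_Ioo ht.1.le htb.le
        exact add_le_add (mul_le_mul_right (lintegral_mono_set i1) _)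
          (mul_le_mul_right (lintegral_mono_set i2) _)

lemma swap_bd (β b : ℝ) (hβ0 : 0 < β) (hb : 1 < b) (δ : ℝ) (hδ : 0 < δ)
    (hbb : 2 / (b - 1) * (b ^ (2 * β) / (2 * β)) ≤ 1 / 2)
    (z : ℝ → ℝ) (hz : Measurable z) (S : Set ℝ) :
    ENNReal.ofReal (2 / (b - 1)) * ∫⁻ t in S, ∫⁻ y in Ioo δ 1,
        (Ioi (y / b)).indicator (fun t => ENNReal.ofReal (t ^ (-(2 * β) - 1))) t
          * ENNReal.ofReal (z y ^ 2)
      ≤ 2⁻¹ * ∫⁻ y in Ioo δ 1, ENNReal.ofReal (z y ^ 2 * y ^ (-(2 * β))) := by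
  have hb0 : 0 < b := by linarith
  have hb' : 0 < b - 1 := by linarith
  have hm : Measurable (Function.uncurry fun t y : ℝ =>
      (Ioi (y / b)).indicator (fun t => ENNReal.ofReal (t ^ (-(2 * β) - 1))) t
          * ENNReal.ofReal (z y ^ 2)) := by
    have hS : MeasurableSet {p : ℝ × ℝ | p.2 / b < p.1} :=
      measurableSet_lt (by fun_prop) (by fun_prop)
    have : Measurable ({p : ℝ × ℝ | p.2 / b < p.1}.indicator
      (fun p => ENNReal.ofReal (p.1 ^ (-(2 * β) - 1)))) := Measurable.indicator (by fun_prop) hS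
    exact this.mul (by fun_prop)
  rw [lintegral_lintegral_swap hm.aemeasurable, ← lintegral_const_mul' _ _ ENNReal.ofReal_ne_top,
    ← lintegral_const_mul' _ _ (by simp)]
  apply setLIntegral_mono' measurableSet_Ioo
  intro y hy
  have hy0 : 0 < y := hδ.trans hy.1
  rw [lintegral_mul_const' _ _ ENNReal.ofReal_ne_top]
  have h1 : ∫⁻ t in S, (Ioi (y / b)).indicator (fun t => ENNReal.ofReal (t ^ (-(2 * β) - 1))) t
      ≤ ENNReal.ofReal ((y / b) ^ (-(2 * β)) / (2 * β)) := by
    rw [← hk_int β hβ0 _ (by positivity), ← lintegral_indicator measurableSet_Ioi]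
    exact setLIntegral_le_lintegral _ _
  have e : (y / b) ^ (-(2 * β)) = y ^ (-(2 * β)) * b ^ (2 * β) := by
    rw [Real.div_rpow hy0.le hb0.le, Real.rpow_neg hb0.le, div_inv_eq_mul]
  calc _ ≤ ENNReal.ofReal (2 / (b - 1)) * (ENNReal.ofReal ((y / b) ^ (-(2 * β)) / (2 * β))
        * ENNReal.ofReal (z y ^ 2)) := by gcongr
    _ = ENNReal.ofReal (2 / (b - 1) * ((y / b) ^ (-(2 * β)) / (2 * β) * z y ^ 2)) := by
        rw [← ENNReal.ofReal_mul (by positivity), ← ENNReal.ofReal_mul (by positivity)]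
    _ ≤ ENNReal.ofReal (1 / 2 * (z y ^ 2 * y ^ (-(2 * β)))) := by
        apply ENNReal.ofReal_le_ofReal
        rw [e]
        calc _ = (2 / (b - 1) * (b ^ (2 * β) / (2 * β))) * (z y ^ 2 * y ^ (-(2 * β))) := by ring
          _ ≤ _ := by gcongr
    _ = _ := by
        rw [ENNReal.ofReal_mul (by norm_num)]
        congr 1
        rw [one_div, ENNReal.ofReal_inv_of_pos (by norm_num)]; simp

lemma trunc_bd (β s b : ℝ) (hβ0 : 0 < β) (hβs : β ≤ s) (hb : 1 < b) (δ : ℝ) (hδ : 0 < δ)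
    (hbb : 2 / (b - 1) * (b ^ (2 * β) / (2 * β)) ≤ 1 / 2)
    (z : ℝ → ℝ) (hz : Measurable z)
    (hN : (∫⁻ t in Set.Ioo (0 : ℝ) 1, ENNReal.ofReal ((z t) ^ 2)) < ⊤) :
    ∫⁻ y in Ioo δ 1, ENNReal.ofReal (z y ^ 2 * y ^ (-(2 * β))) ≤
      ENNReal.ofReal (2 * (2 * (b - 1) ^ (2 * β) + b ^ (2 * β))) *
        ((∫⁻ t in Set.Ioo (0 : ℝ) 1, ENNReal.ofReal ((z t) ^ 2)) + gagliardoSq s z) := by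
  have hb0 : 0 < b := by linarith
  have hb' : 0 < b - 1 := by linarith
  set A := ∫⁻ y in Ioo δ 1, ENNReal.ofReal (z y ^ 2 * y ^ (-(2 * β))) with hA
  set N := ∫⁻ t in Set.Ioo (0 : ℝ) 1, ENNReal.ofReal ((z t) ^ 2) with hNdef
  have tail : ∀ c : ℝ, 0 < c → ∫⁻ y in Ico c 1, ENNReal.ofReal (z y ^ 2 * y ^ (-(2 * β))) ≤
      ENNReal.ofReal (c ^ (-(2 * β))) * N := by
    intro c hc
    calc _ ≤ ∫⁻ y in Ico c 1, ENNReal.ofReal (c ^ (-(2 * β))) * ENNReal.ofReal (z y ^ 2) := by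
          apply setLIntegral_mono' measurableSet_Ico
          intro y hy
          rw [← ENNReal.ofReal_mul (by positivity), mul_comm]
          apply ENNReal.ofReal_le_ofReal
          gcongr ?_ * _
          exact Real.rpow_le_rpow_of_nonpos hc hy.1 (by linarith)
      _ ≤ _ := by
          rw [lintegral_const_mul' _ _ ENNReal.ofReal_ne_top]
          refine mul_le_mul_right (lintegral_mono_set ?_) _
          exact fun y hy => ⟨hc.trans_le hy.1, hy.2⟩
  have hAfin : A ≠ ⊤ := by
    apply ne_top_of_le_ne_top (ENNReal.mul_ne_top (ENNReal.ofReal_ne_top) hN.ne)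
    exact (lintegral_mono_set Ioo_subset_Ico_self).trans (tail δ hδ)
  have hmain : ∫⁻ y in Ioo δ (1 / b), ENNReal.ofReal (z y ^ 2 * y ^ (-(2 * β))) ≤
      ENNReal.ofReal (2 * (b - 1) ^ (2 * β)) * gagliardoSq s z + 2⁻¹ * A := by
    refine (setLIntegral_mono' measurableSet_Ioo
      (fun t ht => inner_bd β s b hβ0 hβs hb δ hδ z hz t ht)).trans ?_
    have hmG : Measurable (fun t => ∫⁻ y in Ioo (0 : ℝ) 1,
        ENNReal.ofReal ((z t - z y) ^ 2 / |t - y| ^ (1 + 2 * s))) := by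
      apply Measurable.lintegral_prod_right'
        (f := fun p : ℝ × ℝ => ENNReal.ofReal ((z p.1 - z p.2) ^ 2 / |p.1 - p.2| ^ (1 + 2 * s)))
      fun_prop
    rw [lintegral_add_left (hmG.const_mul _), lintegral_const_mul' _ _ ENNReal.ofReal_ne_top,
      lintegral_const_mul' _ _ ENNReal.ofReal_ne_top]
    refine add_le_add ?_ (swap_bd β b hβ0 hb δ hδ hbb z hz _)
    unfold gagliardoSq
    gcongr
    rw [div_le_one hb0]; exact hb.le
  have hsum : A ≤ (ENNReal.ofReal (2 * (b - 1) ^ (2 * β)) * gagliardoSq s z + 2⁻¹ * A)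
      + ENNReal.ofReal (b ^ (2 * β)) * N := by
    have hsub : Ioo δ 1 ⊆ Ioo δ (1 / b) ∪ Ico (1 / b) 1 := by
      intro y hy
      rcases lt_or_ge y (1 / b) with h | h
      · exact Or.inl ⟨hy.1, h⟩
      · exact Or.inr ⟨h, hy.2⟩
    refine (lintegral_mono_set hsub).trans ((lintegral_union_le _ _ _).trans ?_)
    refine add_le_add hmain ((tail (1 / b) (by positivity)).trans (le_of_eq ?_))
    congr 2
    rw [one_div, Real.inv_rpow hb0.le, Real.rpow_neg hb0.le, inv_inv]
  set R := ENNReal.ofReal (2 * (b - 1) ^ (2 * β)) * gagliardoSq s z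
      + ENNReal.ofReal (b ^ (2 * β)) * N with hR
  have h1 : 2⁻¹ * A + 2⁻¹ * A ≤ R + 2⁻¹ * A := by
    rw [← add_mul, ENNReal.inv_two_add_inv_two, one_mul, hR]
    refine hsum.trans (le_of_eq (by ring))
  have h2 : 2⁻¹ * A ≤ R :=
    (ENNReal.add_le_add_iff_right (ENNReal.mul_ne_top (by simp) hAfin)).1 h1
  have h3 : A ≤ 2 * R := by
    calc A = 2 * (2⁻¹ * A) := by
          rw [← mul_assoc, ENNReal.mul_inv_cancel (by simp) (by simp), one_mul]
      _ ≤ _ := by gcongr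
  refine h3.trans ?_
  rw [ENNReal.ofReal_mul (by norm_num : (0:ℝ) ≤ 2), ENNReal.ofReal_ofNat, mul_assoc]
  gcongr
  rw [hR, ENNReal.ofReal_add (by positivity) (by positivity), mul_add, add_comm]
  gcongr
  · exact le_add_self
  · exact le_self_add

lemma half_bd (β s b : ℝ) (hβ0 : 0 < β) (hβs : β ≤ s) (hb : 1 < b)
    (hbb : 2 / (b - 1) * (b ^ (2 * β) / (2 * β)) ≤ 1 / 2)
    (z : ℝ → ℝ) (hz : Measurable z)
    (hN : (∫⁻ t in Set.Ioo (0 : ℝ) 1, ENNReal.ofReal ((z t) ^ 2)) < ⊤) :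
    ∫⁻ y in Ioo (0 : ℝ) 1, ENNReal.ofReal (z y ^ 2 * y ^ (-(2 * β))) ≤
      ENNReal.ofReal (2 * (2 * (b - 1) ^ (2 * β) + b ^ (2 * β))) *
        ((∫⁻ t in Set.Ioo (0 : ℝ) 1, ENNReal.ofReal ((z t) ^ 2)) + gagliardoSq s z) := by
  have hU : Ioo (0 : ℝ) 1 = ⋃ n : ℕ, Ioo (1 / ((n : ℝ) + 1)) 1 := by
    ext y
    simp only [mem_iUnion, mem_Ioo]
    constructor
    · rintro ⟨h0, h1⟩
      obtain ⟨n, hn⟩ := exists_nat_one_div_lt h0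
      exact ⟨n, hn, h1⟩
    · rintro ⟨n, hn, h1⟩
      exact ⟨lt_trans (by positivity) hn, h1⟩
  have hmono : Monotone fun n : ℕ => Ioo (1 / ((n : ℝ) + 1)) (1 : ℝ) := by
    intro m n hmn
    exact Ioo_subset_Ioo_left (Nat.one_div_le_one_div hmn)
  conv_lhs => rw [hU]
  rw [setLIntegral_iUnion_of_directed _ hmono.directed_le]
  exact iSup_le fun n => trunc_bd β s b hβ0 hβs hb _ (by positivity) hbb z hz hN

lemma refl_int (f : ℝ → ENNReal) :
    ∫⁻ t in Ioo (0 : ℝ) 1, f (1 - t) = ∫⁻ t in Ioo (0 : ℝ) 1, f t := by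
  have h := (Measure.measurePreserving_sub_left (volume : Measure ℝ) 1).setLIntegral_comp_preimage_emb
    (MeasurableEquiv.subLeft (1 : ℝ)).measurableEmbedding f (Ioo 0 1)
  have e : (fun t : ℝ => 1 - t) ⁻¹' Ioo 0 1 = Ioo 0 1 := by
    simp
  rw [e] at h
  exact h

lemma refl_gag (s : ℝ) (z : ℝ → ℝ) : gagliardoSq s (fun t => z (1 - t)) = gagliardoSq s z := by
  unfold gagliardoSq
  rw [← refl_int]
  congr 1
  ext x
  rw [← refl_int]
  congr 1
  ext y
  simp only [sub_sub_cancel]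
  rw [show 1 - x - (1 - y) = -(x - y) by ring, abs_neg]

/-- Weighted Hardy-type bound via the Gagliardo seminorm: for `0 < β < 1/2` and
`β ≤ s < 1`, `∫₀¹ |z|² (t^{-2β} + (1-t)^{-2β}) dt ≤ C (‖z‖²_{L²(0,1)} + [z]_s²)`. -/
theorem stmt14 (β s : ℝ) (hβ0 : 0 < β) (hβ : β < 1 / 2) (hβs : β ≤ s) (hs : s < 1) :
    ∃ C : ℝ, 0 < C ∧ ∀ z : ℝ → ℝ, Measurable z →
      (∫⁻ t in Set.Ioo (0 : ℝ) 1, ENNReal.ofReal ((z t) ^ 2)) < ⊤ →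
      gagliardoSq s z < ⊤ →
      (∫⁻ t in Set.Ioo (0 : ℝ) 1,
          ENNReal.ofReal ((z t) ^ 2 * (t ^ (-(2 * β)) + (1 - t) ^ (-(2 * β))))) ≤
        ENNReal.ofReal C *
          ((∫⁻ t in Set.Ioo (0 : ℝ) 1, ENNReal.ofReal ((z t) ^ 2)) + gagliardoSq s z) := by
  obtain ⟨b, hb, hbb⟩ := exists_b β hβ0 hβ
  have hb0 : 0 < b := by linarith
  have hb' : 0 < b - 1 := by linarith
  set K := 2 * (2 * (b - 1) ^ (2 * β) + b ^ (2 * β)) with hK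
  have hK0 : 0 < K := by positivity
  refine ⟨K + K, by positivity, fun z hz hN _ => ?_⟩
  have h1 := half_bd β s b hβ0 hβs hb hbb z hz hN
  have hN' := refl_int (fun t => ENNReal.ofReal (z t ^ 2))
  have h2 := half_bd β s b hβ0 hβs hb hbb (fun t => z (1 - t)) (by fun_prop) (by
    rw [hN']; exact hN)
  rw [refl_gag, hN'] at h2
  have h3 := refl_int (fun t => ENNReal.ofReal (z t ^ 2 * (1 - t) ^ (-(2 * β))))
  simp only [sub_sub_cancel] at h3
  rw [h3] at h2
  rw [ENNReal.ofReal_add hK0.le hK0.le, add_mul]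
  refine le_trans (le_of_eq ?_) (add_le_add h1 h2)
  rw [← lintegral_add_left (by fun_prop)]
  apply setLIntegral_congr_fun measurableSet_Ioo
  intro t ht
  have ht0 : 0 < t := ht.1
  have ht1 : 0 < 1 - t := by linarith [ht.2]
  simp only
  rw [mul_add, ENNReal.ofReal_add (by positivity) (by positivity)]
end
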